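/- Estimate for the orthant remainder: Let n ≥ 1, let λ_1,…,λ_n be roots of unity, q_1,…,q_n ∈ ℂ, and k > 1 an integer. There is a constant K, depending only on n, k, q_1,…,q_n and λ_1,…,λ_n, such that for every compactly supported g : ℝ^n → ℂ of class C^{nk}, |R^{st}_{q,k}(λ_1,…,λ_n; g)| ≤ K · sup ‖∂_1^{j_1} ⋯ ∂_n^{j_n} g‖_{L^1(ℝ^n)}, the supremum taken over all n-tuples (j_1,…,j_n) of nonnegative integers with k ≤ j_1 + ⋯ + j_n ≤ nk. -/

import Mathlib

open scoped BigOperators Classical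
open MeasureTheory

/-- Coefficients of the Todd power series `Td(S) = S/(1-e^{-S}) = ∑ bernoulli' n · Sⁿ/n!`. -/
noncomputable def toddCoeff (j : ℕ) : ℂ := (bernoulli' j : ℂ) / j.factorial

/-- Coefficients of the Hirzebruch power series `χ_q(S) = q·Td(S) + (1-q)·Td(-S)`. -/
noncomputable def chiCoeff (q : ℂ) (j : ℕ) : ℂ :=
  q * toddCoeff j + (1 - q) * (-1) ^ j * toddCoeff j

/-- `P_m(x) = B_m({x})/m!`. -/
noncomputable def periodicBernoulli (m : ℕ) (x : ℝ) : ℂ :=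
  Polynomial.aeval ((Int.fract x : ℝ) : ℂ) (Polynomial.bernoulli m) / m.factorial

/-- The family `Q_{·,λ}`:  for `λ = 1` it is `Q_{m,1} = P_m = B_m({x})/m!`; for a root of
unity `λ ≠ 1` of order `N = orderOf λ`, `Q_{1,λ}(x) = λ^{⌊x⌋+1}/(1-λ)` and, for `m ≥ 2`,
`Q_{m,λ}` is the unique continuous function with `Q_{m,λ}(x) = Q_{m,λ}(0) + ∫₀ˣ Q_{m-1,λ}`
and `∫₀ᴺ Q_{m,λ} = 0`. -/
def IsQFamily (lam : ℂ) (Q : ℕ → ℝ → ℂ) : Prop :=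
  if lam = 1 then ∀ m x, Q m x = periodicBernoulli m x
  else (∀ x : ℝ, Q 1 x = lam ^ (⌊x⌋ + 1) / (1 - lam)) ∧
    ∀ m, 2 ≤ m → Continuous (Q m) ∧
      (∀ x : ℝ, Q m x = Q m 0 + ∫ t in (0 : ℝ)..x, Q (m - 1) t) ∧
      (∫ t in (0 : ℝ)..((orderOf lam : ℕ) : ℝ), Q m t) = 0

/-- Coefficients of the polynomial `N_q^{k,λ}`:  for `λ ≠ 1`,
`N_q^{k,λ}(S) = (q + λ/(1-λ))S + ∑_{j=2}^k Q_{j,λ}(0)Sʲ`; for `λ = 1`,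
`N_q^{k,1}(S) = χ_q^{2⌊k/2⌋}(S)`. -/
noncomputable def Ncoeff (q lam : ℂ) (Q : ℕ → ℝ → ℂ) (k : ℕ) : ℕ → ℂ := fun j =>
  if lam = 1 then (if j ≤ 2 * (k / 2) then chiCoeff q j else 0)
  else (if j = 1 then q + lam / (1 - lam) else if 2 ≤ j ∧ j ≤ k then Q j 0 else 0)

/-- The partial derivative in the `i`-th coordinate direction. -/
noncomputable def coordPartial {n : ℕ} (i : Fin n)
    (H : (Fin n → ℝ) → ℂ) : (Fin n → ℝ) → ℂ :=
  fun x => fderiv ℝ H x (Pi.single i 1)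

/-- The mixed partial derivative `∂^{j₁}_{h₁} ⋯ ∂^{jₙ}_{hₙ} H`. -/
noncomputable def mixedPartial {n : ℕ} (j : Fin n → ℕ)
    (H : (Fin n → ℝ) → ℂ) : (Fin n → ℝ) → ℂ :=
  (List.finRange n).foldr (fun i G => (coordPartial i)^[j i] G) H

/-- `[∏ i, pᵢ(∂/∂hᵢ)] H |_{h=0}`, where `pᵢ` has coefficients `c i` and all the `pᵢ`
have degree `≤ k`. -/
noncomputable def opApply {n : ℕ} (c : Fin n → ℕ → ℂ) (k : ℕ)
    (H : (Fin n → ℝ) → ℂ) : ℂ :=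
  ∑ j ∈ Fintype.piFinset (fun _ : Fin n => Finset.range (k + 1)),
    (∏ i, c i (j i)) * mixedPartial j H 0

/-- The dilated standard orthant `O(h) = {t : tᵢ ≥ -hᵢ for all i}`. -/
def stdOrthant (n : ℕ) (h : Fin n → ℝ) : Set (Fin n → ℝ) := {t | ∀ i, -h i ≤ t i}

/-- The remainder `R^{st}_{q,k}(λ₁,…,λₙ; g)` for the standard orthant. -/
noncomputable def orthantRemainder {n : ℕ} (q lam : Fin n → ℂ)
    (Q : Fin n → ℕ → ℝ → ℂ) (k : ℕ) (g : (Fin n → ℝ) → ℂ) : ℂ :=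
  ∑ I ∈ Finset.univ.powerset.erase (Finset.univ : Finset (Fin n)),
    (-1 : ℂ) ^ ((k - 1) * (n - I.card)) *
      opApply
        (fun i => if i ∈ I then Ncoeff (q i) (lam i) (Q i) k
          else fun j => if j = 0 then 1 else 0) k
        (fun h => ∫ t in stdOrthant n h,
          (∏ i ∈ Iᶜ, Q i k (t i)) *
            mixedPartial (fun i => if i ∈ I then 0 else k) g t)


section PartialDerivatives

variable {n : ℕ}

theorem ContDiff.coordPartial {m : ℕ} {f : (Fin n → ℝ) → ℂ} (hf : ContDiff ℝ (m + 1 : ℕ) f)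
    (i : Fin n) : ContDiff ℝ m (coordPartial i f) := by
  have h : ContDiff ℝ m (fderiv ℝ f) := hf.fderiv_right (by norm_cast)
  exact h.clm_apply contDiff_const

theorem HasCompactSupport.coordPartial {f : (Fin n → ℝ) → ℂ} (hf : HasCompactSupport f)
    (i : Fin n) : HasCompactSupport (coordPartial i f) := by
  refine (hf.fderiv (𝕜 := ℝ)).comp_left (g := fun L : (Fin n → ℝ) →L[ℝ] ℂ => L (Pi.single i 1)) rfl

theorem coordPartial_smul (c : ℂ) (f : (Fin n → ℝ) → ℂ) (i : Fin n) :
    coordPartial i (c • f) = c • coordPartial i f := by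
  funext x
  simp [coordPartial, fderiv_const_smul_field]

theorem coordPartial_iterate_smul (c : ℂ) (f : (Fin n → ℝ) → ℂ) (i : Fin n) (m : ℕ) :
    (coordPartial i)^[m] (c • f) = c • (coordPartial i)^[m] f := by
  induction m generalizing f with
  | zero => rfl
  | succ m ih => rw [Function.iterate_succ_apply, coordPartial_smul, ih,
      Function.iterate_succ_apply]

theorem coordPartial_comm {f : (Fin n → ℝ) → ℂ} (hf : ContDiff ℝ 2 f) (i j : Fin n) :
    coordPartial i (coordPartial j f) = coordPartial j (coordPartial i f) := by
  have hd : Differentiable ℝ (fderiv ℝ f) :=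
    (hf.fderiv_right (m := 1) (by norm_num)).differentiable (by norm_num)
  have key : ∀ a b : Fin n, ∀ x, coordPartial a (coordPartial b f) x =
      fderiv ℝ (fderiv ℝ f) x (Pi.single a 1) (Pi.single b 1) := by
    intro a b x
    change fderiv ℝ (fun y => fderiv ℝ f y (Pi.single b 1)) x (Pi.single a 1) = _
    rw [fderiv_clm_apply (hd x) (differentiableAt_const _)]
    simp
  funext x
  rw [key, key]
  exact (hf.contDiffAt.isSymmSndFDerivAt (by simp)) _ _

theorem ContDiff.coordPartial_iterate {m a : ℕ} {f : (Fin n → ℝ) → ℂ}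
    (hf : ContDiff ℝ (m + a : ℕ) f) (i : Fin n) :
    ContDiff ℝ m ((_root_.coordPartial i)^[a] f) := by
  induction a generalizing f with
  | zero => exact hf
  | succ a ih =>
    rw [Function.iterate_succ_apply]
    exact ih (hf.coordPartial i)

theorem HasCompactSupport.coordPartial_iterate {f : (Fin n → ℝ) → ℂ} (hf : HasCompactSupport f)
    (i : Fin n) (a : ℕ) : HasCompactSupport ((_root_.coordPartial i)^[a] f) := by
  induction a generalizing f with
  | zero => exact hf
  | succ a ih =>
    rw [Function.iterate_succ_apply]
    exact ih (hf.coordPartial i)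

theorem coordPartial_iterate_comm {f : (Fin n → ℝ) → ℂ} {m : ℕ}
    (hf : ContDiff ℝ (1 + m : ℕ) f) (i j : Fin n) :
    coordPartial i ((coordPartial j)^[m] f) = (coordPartial j)^[m] (coordPartial i f) := by
  induction m generalizing f with
  | zero => rfl
  | succ m ih =>
    rw [Function.iterate_succ_apply, Function.iterate_succ_apply,
      ih (ContDiff.coordPartial hf j), coordPartial_comm (hf.of_le _) i j]
    norm_cast
    omega

/-- Mixed partial derivatives along a list of coordinates. -/
noncomputable def listPartial (l : List (Fin n)) (j : Fin n → ℕ) (f : (Fin n → ℝ) → ℂ) :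
    (Fin n → ℝ) → ℂ :=
  l.foldr (fun i G => (coordPartial i)^[j i] G) f

theorem listPartial_cons (i : Fin n) (l : List (Fin n)) (j : Fin n → ℕ) (f : (Fin n → ℝ) → ℂ) :
    listPartial (i :: l) j f = (coordPartial i)^[j i] (listPartial l j f) := rfl

theorem ContDiff.listPartial {m : ℕ} {l : List (Fin n)} {j : Fin n → ℕ} {f : (Fin n → ℝ) → ℂ}
    (hf : ContDiff ℝ (m + (l.map j).sum : ℕ) f) : ContDiff ℝ m (listPartial l j f) := by
  induction l generalizing m with
  | nil => exact hf
  | cons i l ih =>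
    rw [listPartial_cons]
    refine ContDiff.coordPartial_iterate (ih ?_) i
    simpa [add_assoc] using hf

theorem HasCompactSupport.listPartial {f : (Fin n → ℝ) → ℂ} (hf : HasCompactSupport f)
    (l : List (Fin n)) (j : Fin n → ℕ) : HasCompactSupport (listPartial l j f) := by
  induction l with
  | nil => exact hf
  | cons i l ih => exact ih.coordPartial_iterate i _

theorem coordPartial_listPartial_comm {l : List (Fin n)} {j : Fin n → ℕ} {f : (Fin n → ℝ) → ℂ}
    (hf : ContDiff ℝ (1 + (l.map j).sum : ℕ) f) (i : Fin n) :
    coordPartial i (listPartial l j f) = listPartial l j (coordPartial i f) := by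
  induction l with
  | nil => rfl
  | cons a l ih =>
    rw [List.map_cons, List.sum_cons, ← add_assoc] at hf
    rw [listPartial_cons, listPartial_cons, ← ih (hf.of_le (by norm_cast; omega)),
      coordPartial_iterate_comm hf.listPartial]

theorem coordPartial_iterate_listPartial_comm {l : List (Fin n)} {j : Fin n → ℕ} {m : ℕ}
    {f : (Fin n → ℝ) → ℂ} (hf : ContDiff ℝ (m + (l.map j).sum : ℕ) f) (i : Fin n) :
    (coordPartial i)^[m] (listPartial l j f) = listPartial l j ((coordPartial i)^[m] f) := by
  induction m generalizing f with
  | zero => rfl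
  | succ m ih =>
    rw [Function.iterate_succ_apply, Function.iterate_succ_apply,
      coordPartial_listPartial_comm (hf.of_le (by norm_cast; omega))]
    exact ih (ContDiff.coordPartial (hf.of_le (by norm_cast; omega)) i)

theorem listPartial_add {l : List (Fin n)} {j a : Fin n → ℕ} {f : (Fin n → ℝ) → ℂ}
    (hf : ContDiff ℝ ((l.map j).sum + (l.map a).sum : ℕ) f) :
    listPartial l j (listPartial l a f) = listPartial l (j + a) f := by
  induction l with
  | nil => rfl
  | cons i l ih =>
    simp only [List.map_cons, List.sum_cons] at hf
    rw [listPartial_cons, listPartial_cons, listPartial_cons, Pi.add_apply,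
      Function.iterate_add_apply, ← ih (hf.of_le (by norm_cast; omega)),
      ← coordPartial_iterate_listPartial_comm (f := listPartial l a f)]
    refine ContDiff.listPartial (hf.of_le ?_)
    norm_cast
    omega

theorem sum_map_finRange (j : Fin n → ℕ) : ((List.finRange n).map j).sum = ∑ i, j i := by
  rw [← List.ofFn_eq_map, List.sum_ofFn]

theorem ContDiff.mixedPartial {m : ℕ} {j : Fin n → ℕ} {f : (Fin n → ℝ) → ℂ}
    (hf : ContDiff ℝ (m + ∑ i, j i : ℕ) f) : ContDiff ℝ m (mixedPartial j f) := by
  rw [← sum_map_finRange] at hf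
  exact hf.listPartial

theorem HasCompactSupport.mixedPartial {f : (Fin n → ℝ) → ℂ} (hf : HasCompactSupport f)
    (j : Fin n → ℕ) : HasCompactSupport (mixedPartial j f) :=
  hf.listPartial _ j

theorem mixedPartial_add {j a : Fin n → ℕ} {f : (Fin n → ℝ) → ℂ}
    (hf : ContDiff ℝ (∑ i, (j i + a i) : ℕ) f) :
    mixedPartial j (mixedPartial a f) = mixedPartial (j + a) f := by
  rw [Finset.sum_add_distrib, ← sum_map_finRange, ← sum_map_finRange] at hf
  exact listPartial_add hf

end PartialDerivatives

theorem LipschitzWith.mul_of_norm_le {X : Type*} [PseudoMetricSpace X] {f g : X → ℂ}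
    {C₁ C₂ B₁ B₂ : NNReal} (hf : LipschitzWith C₁ f) (hg : LipschitzWith C₂ g)
    (hf' : ∀ x, ‖f x‖ ≤ B₁) (hg' : ∀ x, ‖g x‖ ≤ B₂) :
    LipschitzWith (B₁ * C₂ + C₁ * B₂) (fun x => f x * g x) := by
  refine LipschitzWith.of_dist_le_mul fun x y => ?_
  have e : f x * g x - f y * g y = f x * (g x - g y) + (f x - f y) * g y := by ring
  have d₁ := hf.dist_le_mul x y
  have d₂ := hg.dist_le_mul x y
  rw [dist_eq_norm] at d₁ d₂
  rw [dist_eq_norm, e]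
  calc _ ≤ ‖f x‖ * ‖g x - g y‖ + ‖f x - f y‖ * ‖g y‖ := by
        refine (norm_add_le _ _).trans ?_
        rw [norm_mul, norm_mul]
    _ ≤ B₁ * (C₂ * dist x y) + (C₁ * dist x y) * B₂ := by
        gcongr
        · exact hf' x
        · exact hg' y
    _ = _ := by push_cast; ring

section OrthantIntegral

variable {n : ℕ}

theorem HasCompactSupport.const_smul_complex {f : (Fin n → ℝ) → ℂ} (hf : HasCompactSupport f)
    (c : ℂ) : HasCompactSupport (c • f) :=
  hf.comp_left (g := fun z => c • z) (smul_zero c)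

theorem ContDiff.const_smul_complex {m : ℕ} {f : (Fin n → ℝ) → ℂ} (hf : ContDiff ℝ m f) (c : ℂ) :
    ContDiff ℝ m (c • f) :=
  contDiff_const.mul hf

theorem setIntegral_stdOrthant (φ : (Fin n → ℝ) → ℂ) (h : Fin n → ℝ) :
    ∫ t in stdOrthant n h, φ t = ∫ u in stdOrthant n 0, φ (u - h) := by
  have hm : ∀ h, MeasurableSet (stdOrthant n h) := fun h => by
    have : stdOrthant n h = Set.Ici (-h) := rfl
    rw [this]
    exact measurableSet_Ici
  rw [← integral_indicator (hm h), ← integral_indicator (hm 0),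
    ← integral_sub_right_eq_self _ h]
  congr 1
  funext u
  simp [Set.indicator, stdOrthant]

/-- Rademacher's theorem allows differentiation under the integral over a moving orthant. -/
theorem hasFDerivAt_setIntegral_stdOrthant {φ : (Fin n → ℝ) → ℂ} {C : NNReal}
    (hφ : LipschitzWith C φ) (hs : HasCompactSupport φ) (h : Fin n → ℝ) :
    (∀ᵐ u, DifferentiableAt ℝ φ (u - h)) ∧
    Integrable (fun u => -fderiv ℝ φ (u - h)) (volume.restrict (stdOrthant n 0)) ∧
    HasFDerivAt (fun h => ∫ t in stdOrthant n h, φ t)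
      (∫ u in stdOrthant n 0, -fderiv ℝ φ (u - h)) h := by
  have hae : ∀ᵐ u, DifferentiableAt ℝ φ (u - h) :=
    (measurePreserving_sub_right volume h).quasiMeasurePreserving.ae hφ.ae_differentiableAt
  refine ⟨hae, ?_⟩
  simp_rw [setIntegral_stdOrthant φ]
  obtain ⟨R, hR⟩ := hs.isBounded.subset_closedBall (0 : Fin n → ℝ)
  refine hasFDerivAt_integral_of_dominated_loc_of_lip (s := Metric.ball h 1)
    (bound := (Metric.closedBall (0 : Fin n → ℝ) (R + ‖h‖ + 1)).indicator fun _ => (C : ℝ))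
    (Metric.ball_mem_nhds h one_pos) ?_ ?_ ?_ ?_ ?_ ?_
  · exact Filter.Eventually.of_forall fun x =>
      (hφ.continuous.comp (continuous_id.sub continuous_const)).aestronglyMeasurable
  · have := (hφ.continuous.integrable_of_hasCompactSupport hs (μ := volume)).comp_sub_right h
    exact this.integrableOn
  · exact (((measurable_fderiv ℝ φ).comp (measurable_id.sub_const h)).neg).aestronglyMeasurable
  · refine Filter.Eventually.of_forall fun u => ?_
    by_cases hu : u ∈ Metric.closedBall (0 : Fin n → ℝ) (R + ‖h‖ + 1)
    · rw [Set.indicator_of_mem hu]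
      refine LipschitzWith.lipschitzOnWith ?_
      have : Real.nnabs (C : ℝ) = C := by simp
      rw [this]
      refine LipschitzWith.of_dist_le_mul fun x y => ?_
      simpa only [dist_sub_left] using hφ.dist_le_mul (u - x) (u - y)
    · rw [Set.indicator_of_notMem hu]
      have hz : ∀ x ∈ Metric.ball h 1, φ (u - x) = 0 := by
        intro x hx
        by_contra hne
        apply hu
        have h1 := hR (subset_tsupport φ hne)
        rw [mem_closedBall_zero_iff] at h1 ⊢
        rw [mem_ball_iff_norm] at hx
        have h2 : u = (u - x) + ((x - h) + h) := by abel
        rw [h2]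
        have := norm_add_le (u - x) ((x - h) + h)
        have := norm_add_le (x - h) h
        linarith
      intro x hx y hy
      simp [hz x hx, hz y hy]
  · rw [integrable_indicator_iff Metric.isClosed_closedBall.measurableSet]
    have : volume (Metric.closedBall (0 : Fin n → ℝ) (R + ‖h‖ + 1)) < ⊤ := measure_closedBall_lt_top
    exact (integrableOn_const this.ne).mono_measure Measure.restrict_le_self
  · refine ae_restrict_of_ae (hae.mono fun u hu => ?_)
    have h1 : HasFDerivAt (fun x : Fin n → ℝ => u - x)
        (-ContinuousLinearMap.id ℝ (Fin n → ℝ)) h := (hasFDerivAt_id h).const_sub u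
    have := hu.hasFDerivAt.comp h h1
    simpa [Function.comp_def] using this

theorem coordPartial_setIntegral_stdOrthant {W f : (Fin n → ℝ) → ℂ} {C B : NNReal} {i : Fin n}
    (hW : LipschitzWith C W) (hB : ∀ t, ‖W t‖ ≤ B)
    (hWi : ∀ t (r : ℝ), W (t + r • Pi.single i 1) = W t)
    (hf : ContDiff ℝ 1 f) (hs : HasCompactSupport f) :
    coordPartial i (fun h => ∫ t in stdOrthant n h, W t * f t) =
      fun h => ∫ t in stdOrthant n h, W t * ((-1 : ℂ) • coordPartial i f) t := by
  obtain ⟨Cf, hCf⟩ := ContDiff.lipschitzWith_of_hasCompactSupport hs hf one_ne_zero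
  obtain ⟨Bf, hBf⟩ := hs.exists_bound_of_continuous hf.continuous
  have hφ : LipschitzWith (B * Cf + C * Bf.toNNReal) (fun t => W t * f t) :=
    hW.mul_of_norm_le hCf hB fun t => (hBf t).trans (Real.le_coe_toNNReal _)
  funext h
  obtain ⟨hae, hint, hd⟩ := hasFDerivAt_setIntegral_stdOrthant hφ hs.mul_left h
  rw [coordPartial, hd.fderiv, ContinuousLinearMap.integral_apply hint,
    setIntegral_stdOrthant (fun t => W t * ((-1 : ℂ) • coordPartial i f) t)]
  refine integral_congr_ae (ae_restrict_of_ae (hae.mono fun u hu => ?_))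
  have h1 : HasLineDerivAt ℝ (fun t => W t * f t) (W (u - h) * coordPartial i f (u - h)) (u - h)
      (Pi.single i 1) := by
    have h2 := (hf.differentiable one_ne_zero (u - h)).hasFDerivAt.hasLineDerivAt
      (Pi.single i (1 : ℝ))
    simp only [HasLineDerivAt, hWi] at h2 ⊢
    exact h2.const_mul _
  have h3 := h1.unique (hu.hasFDerivAt.hasLineDerivAt (Pi.single i 1))
  simp only [neg_apply, ← h3]
  simp

theorem coordPartial_iterate_setIntegral_stdOrthant {W f : (Fin n → ℝ) → ℂ} {C B : NNReal}
    {i : Fin n} {m : ℕ} (hW : LipschitzWith C W) (hB : ∀ t, ‖W t‖ ≤ B)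
    (hWi : m ≠ 0 → ∀ t (r : ℝ), W (t + r • Pi.single i 1) = W t)
    (hf : ContDiff ℝ m f) (hs : HasCompactSupport f) :
    (coordPartial i)^[m] (fun h => ∫ t in stdOrthant n h, W t * f t) =
      fun h => ∫ t in stdOrthant n h, W t * ((-1 : ℂ) ^ m • (coordPartial i)^[m] f) t := by
  induction m generalizing f with
  | zero => simp
  | succ m ih =>
    have hWi' := hWi (Nat.succ_ne_zero m)
    rw [Function.iterate_succ_apply, coordPartial_setIntegral_stdOrthant hW hB hWi'
      (hf.of_le (by norm_cast; omega)) hs, ih (fun _ => hWi')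
      ((ContDiff.coordPartial hf i).const_smul_complex _) ((hs.coordPartial i).const_smul_complex _)]
    simp only [coordPartial_iterate_smul, smul_smul, pow_succ, Function.iterate_succ_apply]

theorem listPartial_setIntegral_stdOrthant {W f : (Fin n → ℝ) → ℂ} {C B : NNReal}
    {l : List (Fin n)} {j : Fin n → ℕ} (hW : LipschitzWith C W) (hB : ∀ t, ‖W t‖ ≤ B)
    (hWi : ∀ i, j i ≠ 0 → ∀ t (r : ℝ), W (t + r • Pi.single i 1) = W t)
    (hf : ContDiff ℝ (l.map j).sum f) (hs : HasCompactSupport f) :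
    listPartial l j (fun h => ∫ t in stdOrthant n h, W t * f t) =
      fun h => ∫ t in stdOrthant n h,
        W t * ((-1 : ℂ) ^ (l.map j).sum • listPartial l j f) t := by
  induction l with
  | nil => simp [listPartial]
  | cons i l ih =>
    rw [List.map_cons, List.sum_cons] at hf
    rw [listPartial_cons, ih (hf.of_le (by norm_cast; omega)),
      coordPartial_iterate_setIntegral_stdOrthant hW hB (hWi i)
        ((ContDiff.listPartial hf).const_smul_complex _) ((hs.listPartial l j).const_smul_complex _)]
    simp only [coordPartial_iterate_smul, smul_smul, ← pow_add, List.map_cons, List.sum_cons,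
      listPartial_cons]

theorem norm_mixedPartial_setIntegral_stdOrthant_le {W f : (Fin n → ℝ) → ℂ} {C B : NNReal}
    {j : Fin n → ℕ} (hW : LipschitzWith C W) (hB : ∀ t, ‖W t‖ ≤ B)
    (hWi : ∀ i, j i ≠ 0 → ∀ t (r : ℝ), W (t + r • Pi.single i 1) = W t)
    (hf : ContDiff ℝ (∑ i, j i : ℕ) f) (hs : HasCompactSupport f) (h : Fin n → ℝ) :
    ‖mixedPartial j (fun h => ∫ t in stdOrthant n h, W t * f t) h‖ ≤
      B * ∫ t, ‖mixedPartial j f t‖ := by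
  have hc : Continuous (mixedPartial j f) :=
    (ContDiff.mixedPartial (m := 0) (by simpa using hf)).continuous
  have hint : Integrable (fun t => B * ‖mixedPartial j f t‖) :=
    ((hc.integrable_of_hasCompactSupport (hs.mixedPartial j)).norm).const_mul _
  rw [← sum_map_finRange] at hf
  rw [show mixedPartial j (fun h => ∫ t in stdOrthant n h, W t * f t) = _ from
    listPartial_setIntegral_stdOrthant hW hB hWi hf hs, ← integral_const_mul]
  refine (norm_integral_le_of_norm_le hint.integrableOn
    (Filter.Eventually.of_forall fun t => ?_)).trans
    (setIntegral_le_integral hint (Filter.Eventually.of_forall fun t => by positivity))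
  rw [Pi.smul_apply, norm_mul, norm_smul, norm_pow, norm_neg, norm_one, one_pow, one_mul]
  exact mul_le_mul_of_nonneg_right (hB t) (norm_nonneg _)

end OrthantIntegral

section QFamily

/-- A function on `ℝ` which is bounded and Lipschitz. -/
def BoundedLipschitz {X : Type*} [PseudoEMetricSpace X] (W : X → ℂ) : Prop :=
  ∃ C B : NNReal, LipschitzWith C W ∧ ∀ t, ‖W t‖ ≤ B

theorem BoundedLipschitz.prod {X ι : Type*} [PseudoMetricSpace X] {W : ι → X → ℂ} (s : Finset ι)
    (hW : ∀ i ∈ s, BoundedLipschitz (W i)) : BoundedLipschitz (fun t => ∏ i ∈ s, W i t) := by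
  induction s using Finset.induction_on with
  | empty => exact ⟨0, 1, by simp, by simp⟩
  | insert a s ha ih =>
    obtain ⟨C₁, B₁, h₁, h₁'⟩ := hW a (Finset.mem_insert_self a s)
    obtain ⟨C₂, B₂, h₂, h₂'⟩ := ih fun i hi => hW i (Finset.mem_insert_of_mem hi)
    simp_rw [Finset.prod_insert ha]
    refine ⟨_, B₁ * B₂, h₁.mul_of_norm_le h₂ h₁' h₂', fun t => ?_⟩
    rw [norm_mul]
    push_cast
    exact mul_le_mul (h₁' t) (h₂' t) (norm_nonneg _) B₁.2

theorem boundedLipschitz_periodicBernoulli {m : ℕ} (hm : m ≠ 1) :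
    BoundedLipschitz (periodicBernoulli m) := by
  set p : ℝ → ℂ := fun x => Polynomial.aeval (x : ℂ) (Polynomial.bernoulli m) / m.factorial
    with hp
  have hpc : ContDiff ℝ 1 p := by
    refine ContDiff.div_const ?_ _
    simp_rw [Polynomial.aeval_def, Polynomial.eval₂_eq_sum_range]
    have := Complex.ofRealCLM.contDiff (n := 1)
    exact ContDiff.sum fun i _ => contDiff_const.mul (this.pow i)
  have hp01 : p 0 = p 1 := by
    have h0 := Polynomial.aeval_algebraMap_apply ℂ (0 : ℚ) (Polynomial.bernoulli m)
    have h1 := Polynomial.aeval_algebraMap_apply ℂ (1 : ℚ) (Polynomial.bernoulli m)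
    rw [map_zero] at h0
    rw [map_one] at h1
    simp only [hp, Complex.ofReal_zero, Complex.ofReal_one, h0, h1, Polynomial.coe_aeval_eq_eval,
      Polynomial.bernoulli_eval_zero, Polynomial.bernoulli_eval_one,
      bernoulli_eq_bernoulli'_of_ne_one hm]
  obtain ⟨C, hC⟩ := hpc.contDiffOn.exists_lipschitzOnWith one_ne_zero (convex_Icc (0 : ℝ) 1)
    isCompact_Icc
  obtain ⟨B, hB⟩ := isCompact_Icc.exists_bound_of_continuousOn (s := Set.Icc (0 : ℝ) 1)
    hpc.continuous.continuousOn
  have hfr : ∀ x : ℝ, Int.fract x ∈ Set.Icc (0 : ℝ) 1 := fun x =>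
    ⟨Int.fract_nonneg x, (Int.fract_lt_one x).le⟩
  have hP : ∀ x, periodicBernoulli m x = p (Int.fract x) := fun x => rfl
  refine ⟨C, B.toNNReal, ?_, fun x => (hB _ (hfr x)).trans (Real.le_coe_toNNReal _)⟩
  have key : ∀ x y : ℝ, x ≤ y →
      dist (periodicBernoulli m x) (periodicBernoulli m y) ≤ C * dist x y := by
    intro x y hxy
    rw [hP, hP]
    rcases (Int.floor_mono hxy).eq_or_lt with he | hlt
    · refine (hC.dist_le_mul _ (hfr x) _ (hfr y)).trans_eq ?_
      rw [Int.fract, Int.fract, he, dist_sub_right]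
    · have hle : (⌊x⌋ : ℝ) + 1 ≤ ⌊y⌋ := by exact_mod_cast hlt
      have d₁ := hC.dist_le_mul _ (hfr x) 1 (by simp)
      have d₂ := hC.dist_le_mul 0 (by simp) _ (hfr y)
      have hx := Int.fract_lt_one x
      have hy := Int.fract_nonneg y
      rw [Real.dist_eq, abs_of_nonpos (by linarith)] at d₁ d₂
      rw [Real.dist_eq, abs_of_nonpos (by linarith)]
      calc _ ≤ dist (p (Int.fract x)) (p 1) + dist (p 1) (p (Int.fract y)) := dist_triangle _ _ _
        _ ≤ C * -(Int.fract x - 1) + C * -(0 - Int.fract y) := add_le_add d₁ (hp01 ▸ d₂)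
        _ = C * (1 - Int.fract x + Int.fract y) := by ring
        _ ≤ C * -(x - y) := by
          gcongr
          have := Int.self_sub_floor x
          have := Int.self_sub_floor y
          linarith
  refine LipschitzWith.of_dist_le_mul fun x y => ?_
  rcases le_total x y with h | h
  · exact key x y h
  · rw [dist_comm, dist_comm x]
    exact key y x h

/-- An antiderivative of a bounded periodic function with mean zero is bounded and Lipschitz. -/
theorem boundedLipschitz_of_integral {P Q : ℝ → ℂ} {N B : ℝ} (hN : 0 < N)
    (hPB : ∀ x, ‖P x‖ ≤ B) (hPi : ∀ a b : ℝ, IntervalIntegrable P volume a b)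
    (hPp : Function.Periodic P N) (hP0 : ∫ t in (0 : ℝ)..N, P t = 0)
    (hQ : ∀ x, Q x = Q 0 + ∫ t in (0 : ℝ)..x, P t) :
    Function.Periodic Q N ∧ BoundedLipschitz Q := by
  have hsub : ∀ x y, Q y - Q x = ∫ t in x..y, P t := fun x y => by
    rw [hQ y, hQ x, add_sub_add_left_eq_sub, intervalIntegral.integral_interval_sub_left (hPi _ _)
      (hPi _ _)]
  have hper : Function.Periodic Q N := fun x => by
    rw [← sub_eq_zero, hsub, hPp.intervalIntegral_add_eq x 0, zero_add, hP0]
  have hlip : LipschitzWith B.toNNReal Q := by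
    refine LipschitzWith.of_dist_le_mul fun x y => ?_
    rw [dist_comm, dist_eq_norm, hsub, dist_comm, Real.dist_eq]
    refine (intervalIntegral.norm_integral_le_of_norm_le_const fun t _ => hPB t).trans ?_
    gcongr
    exact Real.le_coe_toNNReal _
  obtain ⟨M, hM⟩ := (hper.isBounded_of_continuous hN.ne' hlip.continuous).exists_norm_le
  exact ⟨hper, _, M.toNNReal, hlip,
    fun x => (hM _ (Set.mem_range_self x)).trans (Real.le_coe_toNNReal _)⟩

theorem IsQFamily.boundedLipschitz {lam : ℂ} {Q : ℕ → ℝ → ℂ} (hQ : IsQFamily lam Q)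
    (hroot : ∃ N : ℕ, 0 < N ∧ lam ^ N = 1) {m : ℕ} (hm : 2 ≤ m) : BoundedLipschitz (Q m) := by
  by_cases h1 : lam = 1
  · rw [IsQFamily, if_pos h1] at hQ
    rw [funext (hQ m)]
    exact boundedLipschitz_periodicBernoulli (by omega)
  rw [IsQFamily, if_neg h1] at hQ
  obtain ⟨hQ1, hQm⟩ := hQ
  have hfin : IsOfFinOrder lam := isOfFinOrder_iff_pow_eq_one.2 hroot
  have hN : 0 < orderOf lam := hfin.orderOf_pos
  have hN' : (0 : ℝ) < orderOf lam := by exact_mod_cast hN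
  have hnorm : ‖lam‖ = 1 := hfin.norm_eq_one
  have hlam : lam ≠ 0 := by
    rintro rfl
    simp at hnorm
  have hstep : ∀ x, Q 1 (x + 1) = lam * Q 1 x := fun x => by
    rw [hQ1, hQ1, Int.floor_add_one, zpow_add_one₀ hlam (⌊x⌋ + 1)]
    ring
  have hper : Function.Periodic (Q 1) (orderOf lam) := fun x => by
    rw [hQ1, hQ1, Int.floor_add_natCast, add_right_comm, zpow_add₀ hlam (⌊x⌋ + 1), zpow_natCast,
      pow_orderOf_eq_one, mul_one]
  have hB : ∀ x, ‖Q 1 x‖ ≤ ‖1 - lam‖⁻¹ := fun x => by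
    rw [hQ1, norm_div, norm_zpow, hnorm, one_zpow, one_div]
  have hmeas : Measurable (Q 1) := by
    rw [funext hQ1]
    exact ((measurable_of_countable fun z : ℤ => lam ^ (z + 1) / (1 - lam)).comp
      Int.measurable_floor)
  have hint : ∀ a b : ℝ, IntervalIntegrable (Q 1) volume a b := fun a b =>
    (intervalIntegrable_const (c := ‖1 - lam‖⁻¹)).mono_fun hmeas.aestronglyMeasurable
      (Filter.Eventually.of_forall fun x => (hB x).trans (Real.le_norm_self _))
  have hzero : ∫ t in (0 : ℝ)..(orderOf lam : ℕ), Q 1 t = 0 := by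
    have e1 : ∫ t in (0 : ℝ)..(orderOf lam : ℕ), Q 1 (t + 1) =
        lam * ∫ t in (0 : ℝ)..(orderOf lam : ℕ), Q 1 t := by
      simp_rw [hstep]
      exact intervalIntegral.integral_const_mul _ _
    rw [intervalIntegral.integral_comp_add_right, zero_add, add_comm (orderOf lam : ℝ) 1,
      hper.intervalIntegral_add_eq 1 0, zero_add] at e1
    by_contra hne
    exact h1 (mul_right_cancel₀ hne (by rw [← e1, one_mul]))
  have main : ∀ m, 2 ≤ m → Function.Periodic (Q m) (orderOf lam) ∧ BoundedLipschitz (Q m) := by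
    intro m hm
    induction m, hm using Nat.le_induction with
    | base => exact boundedLipschitz_of_integral hN' hB hint hper hzero (hQm 2 le_rfl).2.1
    | succ m hm ih =>
      obtain ⟨hp, C, B, hL, hb⟩ := ih
      exact boundedLipschitz_of_integral hN' hb (fun a b => hL.continuous.intervalIntegrable a b) hp
        (hQm m hm).2.2 (hQm (m + 1) (by omega)).2.1
  exact (main m hm).2

end QFamily

theorem integral_norm_mixedPartial_le_sSup {n k : ℕ} (g : (Fin n → ℝ) → ℂ) {j : Fin n → ℕ}
    (h₁ : k ≤ ∑ i, j i) (h₂ : ∑ i, j i ≤ n * k) :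
    ∫ x, ‖mixedPartial j g x‖ ≤ sSup {r : ℝ | ∃ j : Fin n → ℕ,
      k ≤ (∑ i, j i) ∧ (∑ i, j i) ≤ n * k ∧ r = ∫ x, ‖mixedPartial j g x‖} := by
  refine le_csSup (Set.Finite.bddAbove ?_) ⟨j, h₁, h₂, rfl⟩
  refine ((Set.finite_Iic (fun _ : Fin n => n * k)).image
    fun j => ∫ x, ‖mixedPartial j g x‖).subset ?_
  rintro r ⟨j, -, hj, rfl⟩
  exact ⟨j, fun i => (Finset.single_le_sum (fun _ _ => Nat.zero_le _)
    (Finset.mem_univ i)).trans hj, rfl⟩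

/-- **Estimate for the orthant remainder.**
For roots of unity `λ₁,…,λₙ`, `q₁,…,qₙ ∈ ℂ` and an integer `k > 1`, there is a constant
`K` (depending only on `n`, `k`, the `qᵢ` and the `λᵢ`, and on the family `Q`) such that
for every compactly supported `g : ℝⁿ → ℂ` of class `C^{nk}`,
`|R^{st}_{q,k}(λ₁,…,λₙ; g)| ≤ K · sup ‖∂₁^{j₁}⋯∂ₙ^{jₙ} g‖_{L¹(ℝⁿ)}`,
the supremum over all tuples `(j₁,…,jₙ)` with `k ≤ j₁+⋯+jₙ ≤ nk`. -/
theorem orthantRemainder_estimate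
    (n : ℕ) (hn : 1 ≤ n) (lam q : Fin n → ℂ)
    (hroot : ∀ i, ∃ N : ℕ, 0 < N ∧ lam i ^ N = 1)
    (k : ℕ) (hk : 1 < k)
    (Q : Fin n → ℕ → ℝ → ℂ) (hQ : ∀ i, IsQFamily (lam i) (Q i)) :
    ∃ K : ℝ, ∀ g : (Fin n → ℝ) → ℂ, ContDiff ℝ (n * k : ℕ) g → HasCompactSupport g →
      ‖orthantRemainder q lam Q k g‖ ≤
        K * sSup {r : ℝ | ∃ j : Fin n → ℕ,
          k ≤ (∑ i, j i) ∧ (∑ i, j i) ≤ n * k ∧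
          r = ∫ x, ‖mixedPartial j g x‖} := by
  have hW : ∀ I : Finset (Fin n),
      BoundedLipschitz (fun t : Fin n → ℝ => ∏ i ∈ Iᶜ, Q i k (t i)) := fun I =>
    BoundedLipschitz.prod _ fun i _ => by
      obtain ⟨C, B, hC, hB⟩ := (hQ i).boundedLipschitz (hroot i) hk
      exact ⟨C * 1, B, hC.comp (LipschitzWith.eval i), fun t => hB _⟩
  choose C B hC hB using hW
  set c : Finset (Fin n) → Fin n → ℕ → ℂ := fun I i =>
    if i ∈ I then Ncoeff (q i) (lam i) (Q i) k else fun j => if j = 0 then 1 else 0 with hc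
  refine ⟨∑ I ∈ Finset.univ.powerset.erase (Finset.univ : Finset (Fin n)),
    ∑ j ∈ Fintype.piFinset (fun _ : Fin n => Finset.range (k + 1)), ‖∏ i, c I i (j i)‖ * B I,
    fun g hg hs => ?_⟩
  simp only [orthantRemainder, Finset.sum_mul]
  refine norm_sum_le_of_le _ fun I hI => ?_
  rw [norm_mul, norm_pow, norm_neg, norm_one, one_pow, one_mul]
  refine norm_sum_le_of_le _ fun j hj => ?_
  rw [norm_mul, mul_assoc]
  by_cases hsupp : ∀ i, i ∉ I → j i = 0
  swap
  · push Not at hsupp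
    obtain ⟨i, hi, hji⟩ := hsupp
    have hz : ∏ i, c I i (j i) = 0 :=
      Finset.prod_eq_zero (Finset.mem_univ i) (by simp [hc, hi, hji])
    rw [show (∏ i, (if i ∈ I then Ncoeff (q i) (lam i) (Q i) k
      else fun j => if j = 0 then 1 else 0) (j i)) = 0 from hz]
    simp
  refine mul_le_mul_of_nonneg_left ?_ (norm_nonneg _)
  set a : Fin n → ℕ := fun i => if i ∈ I then 0 else k with ha
  have hjk : ∀ i, j i ≤ k := fun i =>
    Nat.lt_succ_iff.1 (Finset.mem_range.1 (Fintype.mem_piFinset.1 hj i))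
  have hsum : ∑ i, (j i + a i) ≤ n * k := by
    refine (Finset.sum_le_card_nsmul _ _ k fun i _ => ?_).trans (by simp)
    by_cases hi : i ∈ I
    · simp [ha, hi, hjk i]
    · simp [ha, hi, hsupp i hi]
  have hsum' : k ≤ ∑ i, (j i + a i) := by
    obtain ⟨i, hi⟩ : ∃ i, i ∉ I := by
      by_contra! h
      exact (Finset.mem_erase.1 hI).1 (Finset.eq_univ_of_forall h)
    refine le_trans ?_ (Finset.single_le_sum (fun _ _ => Nat.zero_le _) (Finset.mem_univ i))
    simp [ha, hi]
  have hg' : ContDiff ℝ (∑ i, (j i + a i) : ℕ) g := hg.of_le (by exact_mod_cast hsum)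
  refine (norm_mixedPartial_setIntegral_stdOrthant_le (hC I) (hB I) ?_ ?_
    (hs.mixedPartial a) 0).trans (mul_le_mul_of_nonneg_left ?_ (B I).2)
  · intro i hji t r
    have hi : i ∈ I := by
      by_contra h
      exact hji (hsupp i h)
    refine Finset.prod_congr rfl fun b hb => ?_
    have hbi : b ≠ i := by
      rintro rfl
      exact Finset.mem_compl.1 hb hi
    simp [Pi.single_eq_of_ne hbi]
  · rw [Finset.sum_add_distrib] at hg'
    exact hg'.mixedPartial
  · rw [mixedPartial_add hg']
    exact integral_norm_mixedPartial_le_sSup g hsum' hsum
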